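/- For a (v,b,r,λ,ε)-RPBD scheme (Q, \hat P_n), the worst-case risk under the mean squared loss ℓ_2² equals R*_{v,n}(ℓ_2², Q, \hat P_n) = ((re^ε + (v−1)(λe^ε + r − λ)) / ((r−λ)²(e^ε−1)²·n·v)) · ( v(b−r) + (v−1)(r−λ)(e^ε−1) ), and the supremum over P ∈ Δ_v is attained when P is the uniform distribution on {1,…,v}. -/

import Mathlib

open Finset Real
open scoped Classical

noncomputable section

/-- The "row" of an incidence structure: outputs incident to input `x`. -/
def Ix {v : ℕ} {Y : Type*} [Fintype Y] [DecidableEq Y]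
    (I : Finset (Fin v × Y)) (x : Fin v) : Finset Y :=
  Finset.univ.filter (fun y => (x, y) ∈ I)

/-- The "column" of an incidence structure: inputs incident to output `y`. -/
def Iy {v : ℕ} {Y : Type*} [Fintype Y] [DecidableEq Y]
    (I : Finset (Fin v × Y)) (y : Y) : Finset (Fin v) :=
  Finset.univ.filter (fun x => (x, y) ∈ I)

/-- A `(v,b,r,lam)`-regular pairwise-balanced design (RPBD). -/
def IsRPBD {v : ℕ} {Y : Type*} [Fintype Y] [DecidableEq Y]
    (I : Finset (Fin v × Y)) (b r lam : ℕ) : Prop :=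
  0 < v ∧ Fintype.card Y = b ∧ lam < r ∧ r < b ∧
    (∀ x : Fin v, (Ix I x).card = r) ∧
    (∀ x x' : Fin v, x ≠ x' → (Ix I x ∩ Ix I x').card = lam)

/-- A `(v,b,r,k,lam)`-block design: an RPBD that is moreover `k`-uniform, with `0 < k < v`. -/
def IsBlockDesign {v : ℕ} {Y : Type*} [Fintype Y] [DecidableEq Y]
    (I : Finset (Fin v × Y)) (b r k lam : ℕ) : Prop :=
  IsRPBD I b r lam ∧ 0 < k ∧ k < v ∧ ∀ y : Y, (Iy I y).card = k

/-- The (block design / RPBD) privacy mechanism: output `y` has probability `α e^ε` if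
`(x,y) ∈ I` and `α` otherwise, where `α = 1/(r e^ε + b - r)`. -/
def mechQ {v : ℕ} {Y : Type*} [Fintype Y] [DecidableEq Y]
    (I : Finset (Fin v × Y)) (b r : ℕ) (ε : ℝ) (x : Fin v) (y : Y) : ℝ :=
  if (x, y) ∈ I then Real.exp ε / ((r : ℝ) * Real.exp ε + (b : ℝ) - (r : ℝ))
  else 1 / ((r : ℝ) * Real.exp ε + (b : ℝ) - (r : ℝ))

/-- The probability simplex `Δ_v` on `{1,…,v}`. -/
def simplex (v : ℕ) : Set (Fin v → ℝ) :=
  {P | (∀ x, 0 ≤ P x) ∧ ∑ x, P x = 1}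

/-- Marginal distribution of a single privatized output `Y` when `X ~ P`, `Y ~ Q(·|X)`. -/
def outDist {v : ℕ} {Y : Type*} [Fintype Y] (P : Fin v → ℝ) (Q : Fin v → Y → ℝ) (y : Y) : ℝ :=
  ∑ x, P x * Q x y

/-- Joint probability of the i.i.d. outputs `(Y_1,…,Y_n)`. -/
def jointW {v n : ℕ} {Y : Type*} [Fintype Y] (P : Fin v → ℝ) (Q : Fin v → Y → ℝ)
    (ys : Fin n → Y) : ℝ :=
  ∏ i, outDist P Q (ys i)

/-- The count `N_x(Y_1,…,Y_n) = Σ_i 1(Y_i ∈ ℐ_x)`. -/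
def Nx {v n : ℕ} {Y : Type*} [Fintype Y] [DecidableEq Y]
    (I : Finset (Fin v × Y)) (x : Fin v) (ys : Fin n → Y) : ℕ :=
  (Finset.univ.filter (fun i => ys i ∈ Ix I x)).card

/-- The canonical (unbiased) estimator of an RPBD scheme. -/
def canonEst {v n : ℕ} {Y : Type*} [Fintype Y] [DecidableEq Y]
    (I : Finset (Fin v × Y)) (b r lam : ℕ) (ε : ℝ) (x : Fin v) (ys : Fin n → Y) : ℝ :=
  (1 / (((r : ℝ) - (lam : ℝ)) * (Real.exp ε - 1))) *
    ((Nx I x ys : ℝ) * ((r : ℝ) * Real.exp ε + (b : ℝ) - (r : ℝ)) / (n : ℝ)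
      - ((lam : ℝ) * Real.exp ε + ((r : ℝ) - (lam : ℝ))))

/-- The squared `ℓ_2` loss. -/
def l2loss (v : ℕ) (p phat : Fin v → ℝ) : ℝ := ∑ x, (p x - phat x) ^ 2

/-- The risk `R_{v,n}(ℓ, P, Q, P̂_n) = E[ℓ(P, P̂_n(Y_1,…,Y_n))]`. -/
def risk {v : ℕ} {Y : Type*} [Fintype Y] (n : ℕ) (P : Fin v → ℝ) (Q : Fin v → Y → ℝ)
    (L : (Fin v → ℝ) → (Fin v → ℝ) → ℝ) (est : Fin v → (Fin n → Y) → ℝ) : ℝ :=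
  ∑ ys : Fin n → Y, jointW P Q ys * L P (fun x => est x ys)

/-- Marginal equivalence of two schemes: for every `P ∈ Δ_v` and coordinate `x`, the
estimators `P̂_{n,x}` and `P̂'_{n,x}` have the same distribution. -/
def MargEquiv {v : ℕ} {Y Y' : Type*} [Fintype Y] [Fintype Y'] (n : ℕ)
    (Q : Fin v → Y → ℝ) (est : Fin v → (Fin n → Y) → ℝ)
    (Q' : Fin v → Y' → ℝ) (est' : Fin v → (Fin n → Y') → ℝ) : Prop :=
  ∀ P ∈ simplex v, ∀ x : Fin v, ∀ t : ℝ,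
    (∑ ys : Fin n → Y, if est x ys = t then jointW P Q ys else 0)
      = ∑ ys : Fin n → Y', if est' x ys = t then jointW P Q' ys else 0

section Moments

variable {Y : Type*} [Fintype Y] (w f : Y → ℝ)

theorem sum_fin_succ_fun {n : ℕ} (g : (Fin (n + 1) → Y) → ℝ) :
    ∑ ys, g ys = ∑ y, ∑ zs : Fin n → Y, g (Fin.cons y zs) := by
  rw [← Fintype.sum_prod_type']
  exact ((Fin.consEquiv (fun _ : Fin (n + 1) => Y)).sum_comp g).symm

variable {w f}

theorem sum_prod_weight (hw : ∑ y, w y = 1) (n : ℕ) :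
    ∑ ys : Fin n → Y, ∏ i, w (ys i) = 1 := by
  induction n with
  | zero => simp
  | succ n ih =>
    simp [sum_fin_succ_fun, Fin.prod_univ_succ, ← Finset.mul_sum, ih, hw]

/-- First moment of a sum of i.i.d. centered variables. -/
theorem sum_prod_weight_mul_sum (hw : ∑ y, w y = 1) (hf : ∑ y, w y * f y = 0) (n : ℕ) :
    ∑ ys : Fin n → Y, (∏ i, w (ys i)) * ∑ i, f (ys i) = 0 := by
  induction n with
  | zero => simp
  | succ n ih =>
    simp only [sum_fin_succ_fun, Fin.prod_univ_succ, Fin.sum_univ_succ, Fin.cons_zero,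
      Fin.cons_succ]
    have key (y : Y) : ∑ zs : Fin n → Y, (w y * ∏ i, w (zs i)) * (f y + ∑ i, f (zs i))
        = w y * f y := by
      calc _ = w y * f y * ∑ zs : Fin n → Y, ∏ i, w (zs i)
            + w y * ∑ zs : Fin n → Y, (∏ i, w (zs i)) * ∑ i, f (zs i) := by
            rw [Finset.mul_sum, Finset.mul_sum, ← Finset.sum_add_distrib]
            exact Finset.sum_congr rfl fun _ _ => by ring
        _ = _ := by rw [ih, sum_prod_weight hw]; ring
    simp only [key, hf]

/-- Second moment of a sum of i.i.d. centered variables. -/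
theorem sum_prod_weight_mul_sum_sq (hw : ∑ y, w y = 1) (hf : ∑ y, w y * f y = 0) (n : ℕ) :
    ∑ ys : Fin n → Y, (∏ i, w (ys i)) * (∑ i, f (ys i)) ^ 2
      = n * ∑ y, w y * f y ^ 2 := by
  induction n with
  | zero => simp
  | succ n ih =>
    simp only [sum_fin_succ_fun, Fin.prod_univ_succ, Fin.sum_univ_succ, Fin.cons_zero,
      Fin.cons_succ]
    have key (y : Y) : ∑ zs : Fin n → Y, (w y * ∏ i, w (zs i)) * (f y + ∑ i, f (zs i)) ^ 2
        = w y * f y ^ 2 + w y * (n * ∑ y, w y * f y ^ 2) := by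
      calc _ = w y * f y ^ 2 * ∑ zs : Fin n → Y, ∏ i, w (zs i)
            + 2 * w y * f y * ∑ zs : Fin n → Y, (∏ i, w (zs i)) * ∑ i, f (zs i)
            + w y * ∑ zs : Fin n → Y, (∏ i, w (zs i)) * (∑ i, f (zs i)) ^ 2 := by
            rw [Finset.mul_sum, Finset.mul_sum, Finset.mul_sum, ← Finset.sum_add_distrib,
              ← Finset.sum_add_distrib]
            exact Finset.sum_congr rfl fun _ _ => by ring
        _ = _ := by rw [ih, sum_prod_weight_mul_sum hw hf, sum_prod_weight hw]; ring
    simp only [key, Finset.sum_add_distrib, ← Finset.sum_mul, hw]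
    push_cast
    ring

/-- Variance of a binomial count, for an arbitrary event `A`. -/
theorem sum_prod_weight_mul_count_sq [DecidableEq Y] (hw : ∑ y, w y = 1) (A : Finset Y) {q : ℝ}
    (hq : ∑ y ∈ A, w y = q) (n : ℕ) :
    ∑ ys : Fin n → Y, (∏ i, w (ys i))
        * (((Finset.univ.filter fun i => ys i ∈ A).card : ℝ) - n * q) ^ 2
      = n * (q * (1 - q)) := by
  have hA : ∑ y, w y * (if y ∈ A then (1 : ℝ) else 0) = q := by
    simp [← hq]
  have h0 : ∑ y, w y * ((if y ∈ A then (1 : ℝ) else 0) - q) = 0 := by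
    simp only [mul_sub, Finset.sum_sub_distrib, ← Finset.sum_mul, hw, hA]
    ring
  have h2 : ∑ y, w y * ((if y ∈ A then (1 : ℝ) else 0) - q) ^ 2 = q * (1 - q) := by
    have (y : Y) : w y * ((if y ∈ A then (1 : ℝ) else 0) - q) ^ 2
        = (1 - 2 * q) * (w y * (if y ∈ A then (1 : ℝ) else 0)) + q ^ 2 * w y := by
      split_ifs <;> ring
    simp only [this, Finset.sum_add_distrib, ← Finset.mul_sum, hw, hA]
    ring
  rw [← h2, ← sum_prod_weight_mul_sum_sq hw h0]
  simp [Finset.sum_sub_distrib]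

end Moments

section Mechanism

variable {v b r lam : ℕ} {Y : Type*} [Fintype Y] [DecidableEq Y] {I : Finset (Fin v × Y)}

theorem sum_mechQ (x : Fin v) (ε : ℝ) (S : Finset Y) :
    ∑ y ∈ S, mechQ I b r ε x y
      = ((S ∩ Ix I x).card * (Real.exp ε - 1) + S.card)
          / ((r : ℝ) * Real.exp ε + (b : ℝ) - (r : ℝ)) := by
  have (y : Y) : mechQ I b r ε x y
      = ((if y ∈ Ix I x then (1 : ℝ) else 0) * (Real.exp ε - 1) + 1)
          / ((r : ℝ) * Real.exp ε + (b : ℝ) - (r : ℝ)) := by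
    simp only [mechQ, Ix, Finset.mem_filter, Finset.mem_univ, true_and]
    split_ifs <;> ring
  simp only [this, ← Finset.sum_div, Finset.sum_add_distrib, ← Finset.sum_mul]
  simp

theorem IsRPBD.normalizer_pos (h : IsRPBD I b r lam) (ε : ℝ) :
    0 < (r : ℝ) * Real.exp ε + (b : ℝ) - (r : ℝ) := by
  have hb : (r : ℝ) < b := by exact_mod_cast h.2.2.2.1
  have : 0 ≤ (r : ℝ) * Real.exp ε := by positivity
  linarith

theorem IsRPBD.sum_outDist (h : IsRPBD I b r lam) (ε : ℝ) {P : Fin v → ℝ}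
    (hP : ∑ x, P x = 1) : ∑ y, outDist P (mechQ I b r ε) y = 1 := by
  have hD := h.normalizer_pos ε
  obtain ⟨-, hb, -, -, hr, -⟩ := h
  have (x : Fin v) : ∑ y, mechQ I b r ε x y = 1 := by
    rw [sum_mechQ, div_eq_one_iff_eq hD.ne', Finset.univ_inter, hr, Finset.card_univ, hb]
    ring
  simp only [outDist]
  rw [Finset.sum_comm]
  simp only [← Finset.mul_sum, this, mul_one, hP]

theorem IsRPBD.sum_outDist_Ix (h : IsRPBD I b r lam) (ε : ℝ) {P : Fin v → ℝ}
    (hP : ∑ x, P x = 1) (x : Fin v) :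
    ∑ y ∈ Ix I x, outDist P (mechQ I b r ε) y
      = (P x * (((r : ℝ) - lam) * (Real.exp ε - 1)) + (lam * Real.exp ε + (r - lam)))
          / ((r : ℝ) * Real.exp ε + (b : ℝ) - (r : ℝ)) := by
  obtain ⟨-, -, -, -, hr, hlam⟩ := h
  have (x' : Fin v) : P x' * ∑ y ∈ Ix I x, mechQ I b r ε x' y
      = ((if x' = x then P x' else 0) * (((r : ℝ) - lam) * (Real.exp ε - 1))
          + P x' * (lam * Real.exp ε + (r - lam)))
          / ((r : ℝ) * Real.exp ε + (b : ℝ) - (r : ℝ)) := by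
    rw [sum_mechQ, hr]
    split_ifs with hx
    · rw [hx, Finset.inter_self, hr]
      ring
    · rw [hlam x x' (Ne.symm hx)]
      ring
  simp only [outDist]
  rw [Finset.sum_comm]
  simp only [← Finset.mul_sum, this, ← Finset.sum_div, Finset.sum_add_distrib, ← Finset.sum_mul,
    hP]
  simp

theorem IsRPBD.risk_l2loss_eq (h : IsRPBD I b r lam) {n : ℕ} (hn : 0 < n) {ε : ℝ} (hε : 0 < ε)
    {P : Fin v → ℝ} (hP : ∑ x, P x = 1) {c m D : ℝ}
    (hc : c = ((r : ℝ) - lam) * (Real.exp ε - 1))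
    (hm : m = lam * Real.exp ε + (r - lam))
    (hD : D = (r : ℝ) * Real.exp ε + (b : ℝ) - (r : ℝ)) :
    risk n P (mechQ I b r ε) (l2loss v) (canonEst I b r lam ε)
      = ((c + v * m) * D - (c ^ 2 * ∑ x, P x ^ 2 + 2 * c * m + v * m ^ 2)) / (n * c ^ 2) := by
  have hDpos : 0 < D := hD ▸ h.normalizer_pos ε
  have hcpos : 0 < c := by
    have h1 : (lam : ℝ) < r := by exact_mod_cast h.2.2.1
    have h2 : 1 < Real.exp ε := Real.one_lt_exp_iff.mpr hε
    rw [hc]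
    exact mul_pos (sub_pos.mpr h1) (sub_pos.mpr h2)
  have hn' : (0 : ℝ) < n := by exact_mod_cast hn
  have coord (x : Fin v) :
      ∑ ys : Fin n → Y, jointW P (mechQ I b r ε) ys * (P x - canonEst I b r lam ε x ys) ^ 2
        = (P x * c + m) * (D - (P x * c + m)) / (n * c ^ 2) := by
    have hq := h.sum_outDist_Ix ε hP x
    rw [← hc, ← hm, ← hD] at hq
    have hvar := sum_prod_weight_mul_count_sq (h.sum_outDist ε hP) (Ix I x) hq n
    calc _ = (D / (n * c)) ^ 2 * ∑ ys : Fin n → Y, (∏ i, outDist P (mechQ I b r ε) (ys i))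
            * (((Finset.univ.filter fun i => ys i ∈ Ix I x).card : ℝ)
                - n * ((P x * c + m) / D)) ^ 2 := by
          rw [Finset.mul_sum]
          refine Finset.sum_congr rfl fun ys _ => ?_
          simp only [canonEst, jointW, Nx]
          rw [← hc, ← hm, ← hD]
          field_simp
          ring
      _ = _ := by
          rw [hvar]
          field_simp
  have hswap : risk n P (mechQ I b r ε) (l2loss v) (canonEst I b r lam ε)
      = ∑ x, ∑ ys : Fin n → Y,
          jointW P (mechQ I b r ε) ys * (P x - canonEst I b r lam ε x ys) ^ 2 := by
    simp only [risk, l2loss, Finset.mul_sum]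
    exact Finset.sum_comm
  have hexp (x : Fin v) : (P x * c + m) * (D - (P x * c + m))
      = P x * (c * D - 2 * c * m) + (m * D - m ^ 2) - c ^ 2 * P x ^ 2 := by ring
  rw [hswap]
  simp only [coord, ← Finset.sum_div, hexp, Finset.sum_sub_distrib, Finset.sum_add_distrib,
    ← Finset.sum_mul, ← Finset.mul_sum, hP]
  simp only [Finset.sum_const, Finset.card_univ, Fintype.card_fin, nsmul_eq_mul]
  ring

end Mechanism

/-- The worst-case `ℓ_2²` risk of a `(v,b,r,lam,ε)`-RPBD scheme equals
`((re^ε + (v−1)(λe^ε + r − λ)) / ((r−λ)²(e^ε−1)²·n·v)) · (v(b−r) + (v−1)(r−λ)(e^ε−1))`,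
and the supremum over `P ∈ Δ_v` is attained at the uniform distribution. -/
theorem rpbd_worst_case_l2_risk {v n b r lam : ℕ} (hn : 0 < n) {Y : Type*}
    [Fintype Y] [DecidableEq Y] (I : Finset (Fin v × Y))
    (h : IsRPBD I b r lam) (ε : ℝ) (hε : 0 < ε) :
    (∀ P ∈ simplex v,
      risk n P (mechQ I b r ε) (l2loss v) (canonEst I b r lam ε)
        ≤ (((r : ℝ) * Real.exp ε
              + ((v : ℝ) - 1) * ((lam : ℝ) * Real.exp ε + (r : ℝ) - (lam : ℝ)))
            / (((r : ℝ) - (lam : ℝ)) ^ 2 * (Real.exp ε - 1) ^ 2 * (n : ℝ) * (v : ℝ)))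
          * ((v : ℝ) * ((b : ℝ) - (r : ℝ))
              + ((v : ℝ) - 1) * ((r : ℝ) - (lam : ℝ)) * (Real.exp ε - 1)))
    ∧ risk n (fun _ => 1 / (v : ℝ)) (mechQ I b r ε) (l2loss v) (canonEst I b r lam ε)
        = (((r : ℝ) * Real.exp ε
              + ((v : ℝ) - 1) * ((lam : ℝ) * Real.exp ε + (r : ℝ) - (lam : ℝ)))
            / (((r : ℝ) - (lam : ℝ)) ^ 2 * (Real.exp ε - 1) ^ 2 * (n : ℝ) * (v : ℝ)))
          * ((v : ℝ) * ((b : ℝ) - (r : ℝ))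
              + ((v : ℝ) - 1) * ((r : ℝ) - (lam : ℝ)) * (Real.exp ε - 1)) := by
  have hv : (0 : ℝ) < v := by exact_mod_cast h.1
  have hn' : (0 : ℝ) < n := by exact_mod_cast hn
  have hrl : (0 : ℝ) < (r : ℝ) - lam := sub_pos.mpr (by exact_mod_cast h.2.2.1)
  have hE : 0 < Real.exp ε - 1 := sub_pos.mpr (Real.one_lt_exp_iff.mpr hε)
  have hunif : risk n (fun _ => 1 / (v : ℝ)) (mechQ I b r ε) (l2loss v) (canonEst I b r lam ε)
        = (((r : ℝ) * Real.exp ε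
              + ((v : ℝ) - 1) * ((lam : ℝ) * Real.exp ε + (r : ℝ) - (lam : ℝ)))
            / (((r : ℝ) - (lam : ℝ)) ^ 2 * (Real.exp ε - 1) ^ 2 * (n : ℝ) * (v : ℝ)))
          * ((v : ℝ) * ((b : ℝ) - (r : ℝ))
              + ((v : ℝ) - 1) * ((r : ℝ) - (lam : ℝ)) * (Real.exp ε - 1)) := by
    rw [h.risk_l2loss_eq hn hε (by simp [hv.ne']) rfl rfl rfl]
    simp only [Finset.sum_const, Finset.card_univ, Fintype.card_fin, nsmul_eq_mul]
    field_simp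
    ring
  refine ⟨fun P hP => ?_, hunif⟩
  rw [← hunif, h.risk_l2loss_eq hn hε hP.2 rfl rfl rfl,
    h.risk_l2loss_eq hn hε (by simp [hv.ne']) rfl rfl rfl]
  have hsq : ∑ _x : Fin v, (1 / (v : ℝ)) ^ 2 ≤ ∑ x, P x ^ 2 := by
    have hcs := sq_sum_le_card_mul_sum_sq (s := Finset.univ) (f := P)
    rw [hP.2, Finset.card_univ, Fintype.card_fin] at hcs
    calc ∑ _x : Fin v, (1 / (v : ℝ)) ^ 2 = 1 / (v : ℝ) := by
          simp only [Finset.sum_const, Finset.card_univ, Fintype.card_fin, nsmul_eq_mul]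
          field_simp
      _ ≤ _ := by
          rw [div_le_iff₀ hv]
          linarith
  gcongr

end
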